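/- arXiv:1706.06310 — 2 statements merged into one kernel-verified Lean document; each statement's English description precedes it below -/
import Mathlib

section
/- Let n ≥ 4, p < 1, and 0 < τ1 < τ2. Suppose f : S^{n-1} → ℝ satisfies τ1 < f(u) < τ2 for all u ∈ S^{n-1}, and K ∈ K_0^n is a solution of the L_p Minkowski problem dS_{K,p} = f dH^{n-1} with o ∈ ∂K. Then the dimension of the linear span of the normal cone N(K,o) is strictly less than (n+1)/2. -/
open MeasureTheory Set
open scoped ENNReal NNReal RealInnerProductSpace

noncomputable section

/-- Support function of a set `K`. -/
def suppFn {n : ℕ} (K : Set (EuclideanSpace ℝ (Fin n))) (u : EuclideanSpace ℝ (Fin n)) : ℝ :=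
  sSup ((fun y => ⟪u, y⟫) '' K)

/-- Face of `K` with outer normal `u`. -/
def face {n : ℕ} (K : Set (EuclideanSpace ℝ (Fin n))) (u : EuclideanSpace ℝ (Fin n)) :
    Set (EuclideanSpace ℝ (Fin n)) :=
  {z ∈ K | ⟪z, u⟫ = suppFn K u}

/-- Normal cone of `K` at `z`. -/
def normalCone {n : ℕ} (K : Set (EuclideanSpace ℝ (Fin n))) (z : EuclideanSpace ℝ (Fin n)) :
    Set (EuclideanSpace ℝ (Fin n)) :=
  {u | ∀ y ∈ K, ⟪u, y⟫ ≤ ⟪u, z⟫}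

/-- The unit sphere `S^{n-1}` in `ℝ^n`. -/
def unitSphere (n : ℕ) : Set (EuclideanSpace ℝ (Fin n)) :=
  Metric.sphere (0 : EuclideanSpace ℝ (Fin n)) 1

/-- Surface area measure of `K` evaluated on `ω`:
`S_K(ω) = H^{n-1}(⋃_{u ∈ ω} F(K,u))`. -/
def surfMeas {n : ℕ} (K : Set (EuclideanSpace ℝ (Fin n)))
    (ω : Set (EuclideanSpace ℝ (Fin n))) : ℝ≥0∞ :=
  μH[(n : ℝ) - 1] (⋃ u ∈ ω, face K u)

/-- `K ∈ 𝒦₀ⁿ`: compact convex with nonempty interior, containing the origin. -/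
def IsConvexBody0 {n : ℕ} (K : Set (EuclideanSpace ℝ (Fin n))) : Prop :=
  IsCompact K ∧ Convex ℝ K ∧ (interior K).Nonempty ∧ (0 : EuclideanSpace ℝ (Fin n)) ∈ K

/-- `K` is a solution of the `L_p` Minkowski problem `dS_{K,p} = f dH^{n-1}`. -/
def IsLpSolution {n : ℕ} (p : ℝ) (f : EuclideanSpace ℝ (Fin n) → ℝ)
    (K : Set (EuclideanSpace ℝ (Fin n))) : Prop :=
  μH[(n : ℝ) - 1] {u ∈ unitSphere n | suppFn K u = 0} = 0 ∧
  ∀ ω : Set (EuclideanSpace ℝ (Fin n)), MeasurableSet ω →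
    ω ⊆ {u ∈ unitSphere n | 0 < suppFn K u} →
    surfMeas K ω
      = ∫⁻ u in ω, ENNReal.ofReal ((n : ℝ) * f u * suppFn K u ^ (p - 1)) ∂μH[(n : ℝ) - 1]

/-- `x` is a smooth boundary point: the normal cone spans a one-dimensional space. -/
def IsSmoothPt {n : ℕ} (K : Set (EuclideanSpace ℝ (Fin n)))
    (x : EuclideanSpace ℝ (Fin n)) : Prop :=
  Module.finrank ℝ (Submodule.span ℝ (normalCone K x)) = 1

/-- `K` is smooth: every boundary point is a smooth point. -/
def IsSmoothBody {n : ℕ} (K : Set (EuclideanSpace ℝ (Fin n))) : Prop :=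
  ∀ x ∈ frontier K, IsSmoothPt K x

/-- Subgradient of `v` at `x` relative to the domain `Ω`. -/
def subgrad {n : ℕ} (Ω : Set (EuclideanSpace ℝ (Fin n))) (v : EuclideanSpace ℝ (Fin n) → ℝ)
    (x : EuclideanSpace ℝ (Fin n)) : Set (EuclideanSpace ℝ (Fin n)) :=
  {z | ∀ y ∈ Ω, v x + ⟪z, y - x⟫ ≤ v y}

/-- Monge–Ampère measure of `v` (relative to domain `Ω`) evaluated on `ω`. -/
def maMeasure {n : ℕ} (Ω : Set (EuclideanSpace ℝ (Fin n))) (v : EuclideanSpace ℝ (Fin n) → ℝ)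
    (ω : Set (EuclideanSpace ℝ (Fin n))) : ℝ≥0∞ :=
  μH[(n : ℝ)] (⋃ x ∈ ω, subgrad Ω v x)

/-- Hessian matrix of `v : ℝ^n → ℝ` at `x`. -/
def hessMatrix {n : ℕ} (v : EuclideanSpace ℝ (Fin n) → ℝ) (x : EuclideanSpace ℝ (Fin n)) :
    Matrix (Fin n) (Fin n) ℝ :=
  Matrix.of fun i j =>
    fderiv ℝ (fun y => fderiv ℝ v y (EuclideanSpace.single j 1)) x (EuclideanSpace.single i 1)

section helpers
variable {ι E : Type*} [Fintype ι] [DecidableEq ι] [NormedAddCommGroup E] [InnerProductSpace ℝ E]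
  [MeasurableSpace E] [BorelSpace E]

def boxFace (b : OrthonormalBasis ι ℝ E) (r : ι → ℝ) (i : ι) : Set E :=
  {x | |b.repr x i| = r i ∧ ∀ j, |b.repr x j| ≤ r j}

lemma card_ne_real (i : ι) : (Fintype.card {j // j ≠ i} : ℝ) = (Fintype.card ι : ℝ) - 1 := by
  have h : 1 ≤ Fintype.card ι := Fintype.card_pos_iff.mpr ⟨i⟩
  rw [Fintype.card_subtype_compl, Fintype.card_subtype_eq, Nat.cast_sub h, Nat.cast_one]

lemma volume_box (i : ι) (s : ι → ℝ) :
    volume (Set.Icc (fun j : {j // j ≠ i} => - s j) (fun j => s j))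
      = ENNReal.ofReal (∏ j : {j // j ≠ i}, (2 * |s j|)) ∨ ¬ (∀ j, 0 ≤ s j) := by
  by_cases hs : ∀ j, 0 ≤ s j
  · left
    rw [Real.volume_Icc_pi, ENNReal.ofReal_prod_of_nonneg (fun j _ => by positivity)]
    refine Finset.prod_congr rfl fun j _ => ?_
    rw [abs_of_nonneg (hs j)]; congr 1; ring
  · exact Or.inr hs

lemma hausdorff_half_face (b : OrthonormalBasis ι ℝ E) (r : ι → ℝ) (hr : ∀ j, 0 ≤ r j) (i : ι)
    (c : ℝ) :
    μH[(Fintype.card ι : ℝ) - 1] {x | b.repr x i = c ∧ ∀ j, |b.repr x j| ≤ r j}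
      ≤ ((Fintype.card ι : ℝ≥0) : ℝ≥0∞) ^ ((Fintype.card ι : ℝ) - 1) *
        ENNReal.ofReal (∏ j : {j // j ≠ i}, (2 * |r j|)) := by
  set g : ({j // j ≠ i} → ℝ) → E := fun v => c • b i + ∑ j, v j • b j with hg
  have hcard : Fintype.card {j // j ≠ i} ≤ Fintype.card ι := Fintype.card_subtype_le _
  have hL : LipschitzWith (Fintype.card ι : ℝ≥0) g := by
    refine LipschitzWith.of_dist_le_mul fun v w => ?_
    rw [dist_eq_norm, dist_eq_norm]
    have : g v - g w = ∑ j, (v j - w j) • b j := by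
      simp only [hg, sub_smul, Finset.sum_sub_distrib]; abel
    rw [this]
    calc ‖∑ j, (v j - w j) • b j‖ ≤ ∑ j : {j // j ≠ i}, ‖v - w‖ := by
          refine norm_sum_le_of_le _ fun j _ => ?_
          rw [norm_smul, b.orthonormal.1, mul_one]
          exact norm_le_pi_norm (v - w) j
      _ = (Fintype.card {j // j ≠ i} : ℝ) * ‖v - w‖ := by simp
      _ ≤ _ := by
          push_cast
          gcongr
  have hsub : {x | b.repr x i = c ∧ ∀ j, |b.repr x j| ≤ r j} ⊆
      g '' (Set.Icc (fun j : {j // j ≠ i} => - r j) (fun j => r j)) := by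
    rintro x ⟨hx, hxr⟩
    refine ⟨fun j => b.repr x j, ⟨fun j => (abs_le.1 (hxr j)).1, fun j => (abs_le.1 (hxr j)).2⟩, ?_⟩
    simp only [hg]
    conv_rhs => rw [← b.sum_repr x]
    rw [← hx, Fintype.sum_eq_add_sum_subtype_ne _ i]
  have hd : (0:ℝ) ≤ (Fintype.card ι : ℝ) - 1 := by
    rw [← card_ne_real i]; positivity
  refine (measure_mono hsub).trans ((hL.hausdorffMeasure_image_le hd _).trans ?_)
  gcongr
  rw [← card_ne_real i, hausdorffMeasure_pi_real]
  rcases volume_box i r with h | h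
  · exact h.le
  · exact absurd hr h

lemma hausdorff_face (b : OrthonormalBasis ι ℝ E) (r : ι → ℝ) (hr : ∀ j, 0 ≤ r j) (i : ι) :
    μH[(Fintype.card ι : ℝ) - 1] (boxFace b r i)
      ≤ 2 * (((Fintype.card ι : ℝ≥0) : ℝ≥0∞) ^ ((Fintype.card ι : ℝ) - 1) *
        ENNReal.ofReal (∏ j : {j // j ≠ i}, (2 * |r j|))) := by
  have : boxFace b r i ⊆ {x | b.repr x i = r i ∧ ∀ j, |b.repr x j| ≤ r j} ∪
      {x | b.repr x i = - r i ∧ ∀ j, |b.repr x j| ≤ r j} := by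
    rintro x ⟨h1, h2⟩
    rcases eq_or_eq_neg_of_abs_eq h1 with h | h
    · exact Or.inl ⟨h, h2⟩
    · exact Or.inr ⟨h, h2⟩
  refine (measure_mono this).trans ((measure_union_le _ _).trans ?_)
  rw [two_mul]
  exact add_le_add (hausdorff_half_face b r hr i _) (hausdorff_half_face b r hr i _)

lemma exit_exists (b : OrthonormalBasis ι ℝ E) (r : ι → ℝ) (hr : ∀ j, 0 < r j) (x u : E)
    (hu : u ≠ 0) (hx : ∀ j, |b.repr x j| ≤ r j) :
    ∃ s : ℝ, 0 ≤ s ∧ ∃ i, x + s • u ∈ boxFace b r i := by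
  set φ : ℝ → ℝ := fun s => ‖fun i => b.repr (x + s • u) i / r i‖ with hφ
  have hform : ∀ s i, b.repr (x + s • u) i = b.repr x i + s * b.repr u i := by
    intro s i; simp
  have hc : Continuous φ := by
    simp only [hφ, hform]; fun_prop
  have h0 : φ 0 ≤ 1 := by
    refine (pi_norm_le_iff_of_nonneg zero_le_one).2 fun i => ?_
    rw [hform, Real.norm_eq_abs, abs_div, abs_of_pos (hr i), div_le_one (hr i)]
    simpa using hx i
  obtain ⟨i, hi⟩ : ∃ i, b.repr u i ≠ 0 := by
    by_contra! h
    apply hu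
    apply b.repr.injective
    ext i; simpa using h i
  have hi' : 0 < |b.repr u i| := abs_pos.2 hi
  set s1 := 2 * r i / |b.repr u i| with hs1
  have hs1p : 0 ≤ s1 := by have := hr i; positivity
  have h1 : 1 ≤ φ s1 := by
    refine le_trans ?_ (norm_le_pi_norm _ i)
    rw [hform, Real.norm_eq_abs, abs_div, abs_of_pos (hr i), one_le_div (hr i)]
    have h2 : |s1 * b.repr u i| = 2 * r i := by
      rw [abs_mul, abs_of_nonneg hs1p, hs1]; field_simp
    have h3 := abs_sub_abs_le_abs_sub (s1 * b.repr u i) (- b.repr x i)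
    rw [abs_neg, h2, sub_neg_eq_add, add_comm (s1 * _)] at h3
    linarith [hx i]
  obtain ⟨s, hs, hs'⟩ := intermediate_value_Icc hs1p hc.continuousOn ⟨h0, h1⟩
  refine ⟨s, hs.1, ?_⟩
  have hle : ∀ j, |b.repr (x + s • u) j| ≤ r j := by
    intro j
    have := norm_le_pi_norm (fun i => b.repr (x + s • u) i / r i) j
    rw [show ‖fun i => b.repr (x + s • u) i / r i‖ = 1 from hs', Real.norm_eq_abs, abs_div,
      abs_of_pos (hr j), div_le_one (hr j)] at this
    exact this
  by_contra! hcon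
  have : φ s < 1 := by
    refine (pi_norm_lt_iff zero_lt_one).2 fun j => ?_
    rw [Real.norm_eq_abs, abs_div, abs_of_pos (hr j), div_lt_one (hr j)]
    exact lt_of_le_of_ne (hle j) fun h => hcon j ⟨h, hle⟩
  exact absurd hs' this.ne

lemma hausdorff_convex_surface (b : OrthonormalBasis ι ℝ E) (r : ι → ℝ) (hr : ∀ j, 0 < r j)
    (T : Set E) (hT : ∀ x ∈ T, ∀ j, |b.repr x j| ≤ r j)
    (hN : ∀ x ∈ T, ∃ u : E, u ≠ 0 ∧ ∀ y ∈ T, ⟪u, y - x⟫ ≤ 0) {d : ℝ} (hd : 0 ≤ d) :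
    μH[d] T ≤ ∑ i, μH[d] (boxFace b r i) := by
  have hex : ∀ x : T, ∃ u : E, (∀ y ∈ T, ⟪u, y - x⟫ ≤ 0) ∧
      ∃ s : ℝ, 0 ≤ s ∧ ∃ i, (x : E) + s • u ∈ boxFace b r i := by
    intro x
    obtain ⟨u, hu, h⟩ := hN x x.2
    exact ⟨u, h, exit_exists b r hr x u hu (hT x x.2)⟩
  choose u hu s hs i hi using hex
  set e : T → E := fun x => (x : E) + s x • u x with he
  have hA : AntilipschitzWith 1 e := by
    refine AntilipschitzWith.of_le_mul_dist fun x y => ?_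
    rw [NNReal.coe_one, one_mul, Subtype.dist_eq, dist_eq_norm, dist_eq_norm]
    have h1 := mul_nonneg (hs x) (neg_nonneg.2 (hu x y y.2))
    have h2 := mul_nonneg (hs y) (neg_nonneg.2 (hu y x x.2))
    have h3 : ‖(x : E) - y‖ ^ 2 ≤ ‖(x : E) - y‖ * ‖e x - e y‖ := by
      refine le_trans ?_ (real_inner_le_norm _ _)
      have : e x - e y = ((x : E) - y) + (s x • u x - s y • u y) := by simp only [he]; abel
      rw [this, inner_add_right, real_inner_self_eq_norm_sq, inner_sub_right,
        real_inner_smul_right, real_inner_smul_right, real_inner_comm, real_inner_comm (u y)]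
      have h4 : ⟪u x, (y : E) - x⟫ = - ⟪u x, (x : E) - y⟫ := by
        rw [← inner_neg_right, neg_sub]
      rw [h4] at h1
      linarith
    by_contra! hlt
    have hp : 0 < ‖(x : E) - y‖ := (norm_nonneg _).trans_lt hlt
    nlinarith
  have h1 := hA.le_hausdorffMeasure_image hd (Set.univ : Set T)
  have h2 : μH[d] T = μH[d] (Set.univ : Set T) := by
    rw [← (isometry_subtype_coe (s := T)).hausdorffMeasure_image (Or.inl hd)]
    simp
  rw [h2]
  simp only [ENNReal.coe_one, ENNReal.one_rpow, one_mul] at h1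
  refine h1.trans ?_
  have h3 : e '' Set.univ ⊆ ⋃ i, boxFace b r i := by
    rintro _ ⟨x, -, rfl⟩
    exact Set.mem_iUnion.2 ⟨i x, hi x⟩
  refine (measure_mono h3).trans ?_
  exact measure_iUnion_fintype_le _ _

lemma hausdorff_cap (b : OrthonormalBasis ι ℝ E) (s : ι → ℝ) (hs : ∀ j, 0 ≤ s j) (i : ι)
    (hsum : ∑ j : {j // j ≠ i}, s j ^ 2 ≤ 1) :
    ENNReal.ofReal (∏ j : {j // j ≠ i}, (2 * |s j|)) ≤
      μH[(Fintype.card ι : ℝ) - 1]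
        {u : E | ‖u‖ = 1 ∧ 0 ≤ b.repr u i ∧ ∀ j, j ≠ i → |b.repr u j| ≤ s j} := by
  set π : E → ({j // j ≠ i} → ℝ) := fun x j => b.repr x j with hπ
  have hL : LipschitzWith 1 π := by
    refine LipschitzWith.of_dist_le_mul fun v w => ?_
    rw [NNReal.coe_one, one_mul]
    refine (dist_pi_le_iff dist_nonneg).2 fun j => ?_
    simp only [hπ, b.repr_apply_apply]
    rw [Real.dist_eq, ← inner_sub_right, dist_eq_norm]
    refine (abs_real_inner_le_norm _ _).trans ?_
    rw [b.orthonormal.1, one_mul]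
  have hd : (0:ℝ) ≤ (Fintype.card ι : ℝ) - 1 := by
    rw [← card_ne_real i]; positivity
  have h1 := hL.hausdorffMeasure_image_le hd
    {u : E | ‖u‖ = 1 ∧ 0 ≤ b.repr u i ∧ ∀ j, j ≠ i → |b.repr u j| ≤ s j}
  simp only [ENNReal.coe_one, ENNReal.one_rpow, one_mul] at h1
  refine le_trans ?_ h1
  rcases volume_box i s with h | h
  swap
  · exact absurd hs h
  rw [← h, ← hausdorffMeasure_pi_real, card_ne_real i]
  refine measure_mono ?_
  rintro v ⟨hv1, hv2⟩
  have hvs : ∀ j, |v j| ≤ s j := fun j => abs_le.2 ⟨hv1 j, hv2 j⟩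
  have hv : ∑ j, v j ^ 2 ≤ 1 := by
    refine le_trans (Finset.sum_le_sum fun j _ => ?_) hsum
    exact sq_le_sq' (hv1 j) (hv2 j)
  set w : EuclideanSpace ℝ ι := WithLp.toLp 2
    (fun j => if hj : j = i then √(1 - ∑ j, v j ^ 2) else v ⟨j, hj⟩) with hw
  have hwi : w i = √(1 - ∑ j, v j ^ 2) := by simp [hw]
  have hwj : ∀ j : {j // j ≠ i}, w j = v j := by
    intro j; simp [hw, j.2]
  refine ⟨b.repr.symm w, ⟨?_, ?_, ?_⟩, ?_⟩
  · rw [LinearIsometryEquiv.norm_map, EuclideanSpace.norm_eq, Real.sqrt_eq_one]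
    simp only [Real.norm_eq_abs, sq_abs]
    rw [Fintype.sum_eq_add_sum_subtype_ne _ i, hwi, Real.sq_sqrt (by linarith)]
    simp only [hwj]
    ring
  · rw [LinearIsometryEquiv.apply_symm_apply, hwi]; positivity
  · intro j hj
    rw [LinearIsometryEquiv.apply_symm_apply, hwj ⟨j, hj⟩]; exact hvs _
  · ext j
    simp only [hπ]
    rw [LinearIsometryEquiv.apply_symm_apply, hwj j]

end helpers
section helpers2
variable {E : Type*} [NormedAddCommGroup E] [InnerProductSpace ℝ E] [FiniteDimensional ℝ E]

lemma cone_interior (N : Set E) (hconv : Convex ℝ N) (h0 : (0 : E) ∈ N)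
    (hcone : ∀ c : ℝ, 0 < c → ∀ x ∈ N, c • x ∈ N)
    (hk : 0 < Module.finrank ℝ (Submodule.span ℝ N)) :
    ∃ u : Submodule.span ℝ N, ‖u‖ = 1 ∧ ∃ δ > 0, ∀ v : Submodule.span ℝ N, ‖v - u‖ ≤ δ →
      (v : E) ∈ N := by
  set L := Submodule.span ℝ N with hL
  set N' : Set L := (↑) ⁻¹' N with hN'
  have hc' : Convex ℝ N' := hconv.linear_preimage L.subtype
  have hspan : Submodule.span ℝ N' = ⊤ := Submodule.span_span_coe_preimage
  have h0' : (0 : L) ∈ N' := by simpa [hN'] using h0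
  have haff : affineSpan ℝ N' = ⊤ := by
    have h1 := affineSpan_insert_zero (k := ℝ) N'
    rw [Set.insert_eq_of_mem h0', hspan] at h1
    exact SetLike.coe_injective h1
  have hint : (interior N').Nonempty := hc'.interior_nonempty_iff_affineSpan_eq_top.2 haff
  have : Nontrivial L := Module.finrank_pos_iff.1 hk
  obtain ⟨z, hz, hz0⟩ := (dense_compl_singleton (0 : L)).inter_open_nonempty _ isOpen_interior hint
  have hz0 : z ≠ 0 := by simpa using hz0
  obtain ⟨ε, hε, hball⟩ := Metric.isOpen_iff.1 isOpen_interior z hz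
  have hzn : 0 < ‖z‖ := norm_pos_iff.2 hz0
  refine ⟨‖z‖⁻¹ • z, ?_, ε / 2 / ‖z‖, by positivity, ?_⟩
  · rw [norm_smul, norm_inv, norm_norm, inv_mul_cancel₀ hzn.ne']
  · intro v hv
    have h1 : ‖z‖ • v ∈ Metric.ball z ε := by
      rw [Metric.mem_ball, dist_eq_norm]
      have : ‖z‖ • v - z = ‖z‖ • (v - ‖z‖⁻¹ • z) := by
        rw [smul_sub, smul_inv_smul₀ hzn.ne']
      rw [this, norm_smul, norm_norm]
      calc ‖z‖ * ‖v - ‖z‖⁻¹ • z‖ ≤ ‖z‖ * (ε / 2 / ‖z‖) := by gcongr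
        _ = ε / 2 := by field_simp
        _ < ε := by linarith
    have h2 : ((‖z‖ • v : L) : E) ∈ N := (interior_subset (hball h1) : (‖z‖ • v) ∈ N')
    have h3 := hcone ‖z‖⁻¹ (by positivity) _ h2
    rwa [Submodule.coe_smul, inv_smul_smul₀ hzn.ne'] at h3

lemma adapted_basis (N : Set E) (hconv : Convex ℝ N) (h0 : (0 : E) ∈ N)
    (hcone : ∀ c : ℝ, 0 < c → ∀ x ∈ N, c • x ∈ N) (k m : ℕ)
    (hk : Module.finrank ℝ (Submodule.span ℝ N) = k) (hk0 : 0 < k)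
    (hkm : Module.finrank ℝ E = k + m) :
    ∃ (b : OrthonormalBasis (Fin k ⊕ Fin m) ℝ E) (i0 : Fin k) (δ : ℝ), 0 < δ ∧
      ∀ v : E, (∀ j, b.repr v (Sum.inr j) = 0) → ‖v - b (Sum.inl i0)‖ ≤ δ → v ∈ N := by
  set L := Submodule.span ℝ N with hL
  obtain ⟨u, hu, δ, hδ, h⟩ := cone_interior N hconv h0 hcone (hk.symm ▸ hk0)
  obtain ⟨bL, hbL⟩ := Orthonormal.exists_orthonormalBasis_extension_of_card_eq (𝕜 := ℝ) (E := L)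
    (ι := Fin k) (by simpa using hk) (v := fun _ => u) (s := {⟨0, hk0⟩}) (by
      constructor
      · intro i; exact hu
      · intro i j hij; exact absurd (Subsingleton.elim i j) hij)
  obtain ⟨b, hb⟩ := Orthonormal.exists_orthonormalBasis_extension_of_card_eq (𝕜 := ℝ) (E := E)
    (ι := Fin k ⊕ Fin m) (by simpa using hkm) (v := Sum.elim (fun i => (bL i : E)) (fun _ => 0))
    (s := Set.range Sum.inl) (by
      have ho : Orthonormal ℝ (fun i => (bL i : E)) :=
        bL.orthonormal.comp_linearIsometry L.subtypeₗᵢ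
      constructor
      · rintro ⟨_, i, rfl⟩; exact ho.1 i
      · rintro ⟨_, i, rfl⟩ ⟨_, j, rfl⟩ hij
        exact ho.2 (fun h => hij (by subst h; rfl)))
  have hb' : ∀ i, b (Sum.inl i) = bL i := fun i => hb _ ⟨i, rfl⟩
  refine ⟨b, ⟨0, hk0⟩, δ, hδ, fun v hv hvd => ?_⟩
  have hvL : v ∈ L := by
    rw [← b.sum_repr v, Fintype.sum_sum_type]
    simp only [hv, zero_smul, Finset.sum_const_zero, add_zero, hb']
    exact Submodule.sum_mem _ fun i _ => L.smul_mem _ (bL i).2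
  refine h ⟨v, hvL⟩ ?_
  rw [hb', hbL _ rfl] at hvd
  exact hvd

end helpers2

section helpers3
variable {n : ℕ} {K : Set (EuclideanSpace ℝ (Fin n))}

lemma suppFn_bdd (hK : IsCompact K) (u : EuclideanSpace ℝ (Fin n)) :
    BddAbove ((fun y => ⟪u, y⟫) '' K) :=
  (hK.image (by fun_prop)).bddAbove

lemma le_suppFn (hK : IsCompact K) (u : EuclideanSpace ℝ (Fin n)) {y} (hy : y ∈ K) :
    ⟪u, y⟫ ≤ suppFn K u :=
  le_csSup (suppFn_bdd hK u) ⟨y, hy, rfl⟩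

lemma suppFn_le (hK : K.Nonempty) (u : EuclideanSpace ℝ (Fin n)) {a : ℝ}
    (h : ∀ y ∈ K, ⟪u, y⟫ ≤ a) : suppFn K u ≤ a :=
  csSup_le (hK.image _) (by rintro _ ⟨y, hy, rfl⟩; exact h y hy)

lemma suppFn_continuous (hK : IsCompact K) (h0 : K.Nonempty) {R : ℝ} (hR0 : 0 ≤ R)
    (hR : ∀ x ∈ K, ‖x‖ ≤ R) : Continuous (suppFn K) := by
  have : LipschitzWith ⟨R, hR0⟩ (suppFn K) := by
    refine LipschitzWith.of_le_add_mul _ fun u v => ?_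
    refine suppFn_le h0 u fun y hy => ?_
    have h1 := le_suppFn hK v hy
    have h2 : ⟪u, y⟫ = ⟪v, y⟫ + ⟪u - v, y⟫ := by rw [inner_sub_left]; ring
    have h3 := real_inner_le_norm (u - v) y
    have h4 : ‖u - v‖ * ‖y‖ ≤ ‖u - v‖ * R := by gcongr; exact hR y hy
    rw [dist_eq_norm]
    change _ ≤ _ + R * _
    linarith
  exact this.continuous

lemma normalCone_convex : Convex ℝ (normalCone K 0) := by
  intro x hx y hy a b ha hb _ z hz
  have h1 := hx z hz
  have h2 := hy z hz
  simp only [inner_zero_right] at h1 h2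
  rw [inner_zero_right, inner_add_left, real_inner_smul_left, real_inner_smul_left]
  nlinarith

lemma zero_mem_normalCone : (0 : EuclideanSpace ℝ (Fin n)) ∈ normalCone K 0 := by
  intro z hz; simp

lemma smul_mem_normalCone (c : ℝ) (hc : 0 < c) (x) (hx : x ∈ normalCone K 0) :
    c • x ∈ normalCone K 0 := by
  intro z hz
  have h1 := hx z hz
  simp only [inner_zero_right] at h1
  rw [inner_zero_right, real_inner_smul_left]
  nlinarith

/-- geometric estimate on the cap -/
lemma cap_estimate {k m : ℕ} (hkm : n = k + m)
    (b : OrthonormalBasis (Fin k ⊕ Fin m) ℝ (EuclideanSpace ℝ (Fin n))) (i0 : Fin k) {δ R : ℝ}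
    (hδ : 0 < δ) (hR0 : 0 < R) (hR : ∀ x ∈ K, ‖x‖ ≤ R)
    (hN : ∀ v, (∀ j, b.repr v (Sum.inr j) = 0) → ‖v - b (Sum.inl i0)‖ ≤ δ → v ∈ normalCone K 0)
    {η t : ℝ} (hη : 6 * n * η ≤ δ) (hη0 : 0 < η) (ht : 0 < t) (htη : t ≤ η)
    {u : EuclideanSpace ℝ (Fin n)} (hu : ‖u‖ = 1) (hu0 : 0 ≤ b.repr u (Sum.inl i0))
    (huj : ∀ j, j ≠ Sum.inl i0 → |b.repr u j| ≤ Sum.elim (fun _ => η) (fun _ => t) j)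
    {x : EuclideanSpace ℝ (Fin n)} (hx : x ∈ K) :
    ⟪u, x⟫ ≤ n * R * t ∧ (0 ≤ ⟪u, x⟫ → ∀ i, |b.repr x (Sum.inl i)| ≤ 2 * n * R * t / δ) := by
  have hn1 : (1 : ℝ) ≤ n := by
    have := i0.pos
    exact_mod_cast (by omega : 1 ≤ n)
  have hmn : (m : ℝ) ≤ n := by exact_mod_cast (by omega : m ≤ n)
  set w : EuclideanSpace ℝ (Fin n) := ∑ j : Fin m, b.repr u (Sum.inr j) • b (Sum.inr j) with hw
  have hwn : ‖w‖ ≤ n * t := by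
    calc ‖w‖ ≤ ∑ j : Fin m, t := by
          refine norm_sum_le_of_le _ fun j _ => ?_
          rw [norm_smul, b.orthonormal.1, mul_one]
          exact huj (Sum.inr j) (by simp)
      _ = m * t := by simp
      _ ≤ n * t := by gcongr
  have hwx : ⟪w, x⟫ ≤ n * R * t := by
    calc ⟪w, x⟫ ≤ ‖w‖ * ‖x‖ := real_inner_le_norm _ _
      _ ≤ (n * t) * R := by gcongr; exact hR x hx
      _ = _ := by ring
  have hwr : ∀ j, b.repr w (Sum.inr j) = b.repr u (Sum.inr j) := by
    intro j
    rw [hw, map_sum]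
    simp [OrthonormalBasis.repr_self, Pi.single_apply]
  have hub : ‖u - b (Sum.inl i0)‖ ≤ 2 * n * η := by
    have h1 : ∑ j, b.repr u j ^ 2 = 1 := by
      have := b.repr.norm_map u
      rw [hu, EuclideanSpace.norm_eq, Real.sqrt_eq_one] at this
      simpa using this
    rw [Fintype.sum_eq_add_sum_subtype_ne _ (Sum.inl i0)] at h1
    have h2 : ∑ j : {j // j ≠ (Sum.inl i0 : Fin k ⊕ Fin m)}, b.repr u j ^ 2 ≤ n * η ^ 2 := by
      calc _ ≤ ∑ j : {j // j ≠ (Sum.inl i0 : Fin k ⊕ Fin m)}, η ^ 2 := by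
            refine Finset.sum_le_sum fun j _ => ?_
            have h3 : |b.repr u j| ≤ η := by
              refine (huj j j.2).trans ?_
              rcases j with ⟨j | j, hj⟩
              · simp
              · simpa using htη
            exact sq_le_sq' (abs_le.1 h3).1 (abs_le.1 h3).2
        _ = (Fintype.card {j // j ≠ (Sum.inl i0 : Fin k ⊕ Fin m)} : ℝ) * η ^ 2 := by simp
        _ ≤ _ := by
          gcongr
          rw [hkm]
          simpa using Fintype.card_subtype_le (fun j => j ≠ (Sum.inl i0 : Fin k ⊕ Fin m))
    have h3 : ‖u - b (Sum.inl i0)‖ ^ 2 = 2 - 2 * b.repr u (Sum.inl i0) := by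
      rw [norm_sub_sq_real, hu, b.orthonormal.1, b.repr_apply_apply, real_inner_comm]; ring
    refine abs_le_of_sq_le_sq' ?_ (by positivity) |>.2
    rw [h3]
    have : (n : ℝ) * η ^ 2 ≤ n ^ 2 * η ^ 2 := by
      gcongr; nlinarith
    nlinarith
  have huL : ‖u - w - b (Sum.inl i0)‖ ≤ δ / 2 := by
    calc ‖u - w - b (Sum.inl i0)‖ = ‖(u - b (Sum.inl i0)) - w‖ := by congr 1; abel
      _ ≤ ‖u - b (Sum.inl i0)‖ + ‖w‖ := norm_sub_le _ _
      _ ≤ 2 * n * η + n * t := add_le_add hub hwn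
      _ ≤ 2 * n * η + n * η := by gcongr
      _ ≤ δ / 2 := by linarith
  have hLx : ∀ (i : Fin k) (c : ℝ), |c| ≤ δ / 2 → ⟪u - w, x⟫ + c * b.repr x (Sum.inl i) ≤ 0 := by
    intro i c hc
    have h1 : u - w + c • b (Sum.inl i) ∈ normalCone K 0 := by
      refine hN _ (fun j => ?_) ?_
      · simp [hwr, OrthonormalBasis.repr_self]
      · calc _ = ‖(u - w - b (Sum.inl i0)) + c • b (Sum.inl i)‖ := by congr 1; abel
          _ ≤ ‖u - w - b (Sum.inl i0)‖ + ‖c • b (Sum.inl i)‖ := norm_add_le _ _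
          _ ≤ δ / 2 + δ / 2 := by
            refine add_le_add huL ?_
            rw [norm_smul, b.orthonormal.1, mul_one]; exact hc
          _ = δ := by ring
    have h2 := h1 x hx
    rw [inner_zero_right, inner_add_left, real_inner_smul_left] at h2
    rw [b.repr_apply_apply]; exact h2
  have hsplit : ⟪u, x⟫ = ⟪u - w, x⟫ + ⟪w, x⟫ := by rw [inner_sub_left]; ring
  constructor
  · have := hLx i0 0 (by simp; positivity)
    linarith
  · intro hpos i
    have h1 := hLx i (δ / 2) (by rw [abs_of_pos (by positivity)])
    have h2 := hLx i (-(δ / 2)) (by rw [abs_neg, abs_of_pos (by positivity)])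
    rw [le_div_iff₀ hδ]
    rcases abs_cases (b.repr x (Sum.inl i)) with ⟨h, _⟩ | ⟨h, _⟩ <;> rw [h] <;> nlinarith

end helpers3
/-- **Corollary 1.5 (i).** If `n ≥ 4`, `p < 1` and `K` solves the `L_p` Minkowski
problem with `o ∈ ∂K`, then `dim N(K,o) < (n+1)/2`. -/
theorem stmt6 {n : ℕ} (hn : 4 ≤ n) {p : ℝ} (hp : p < 1) {τ1 τ2 : ℝ}
    (hτ1 : 0 < τ1) (hτ12 : τ1 < τ2) {f : EuclideanSpace ℝ (Fin n) → ℝ}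
    (hf : ∀ u ∈ unitSphere n, τ1 < f u ∧ f u < τ2)
    {K : Set (EuclideanSpace ℝ (Fin n))} (hK : IsConvexBody0 K)
    (hsol : IsLpSolution p f K)
    (ho : (0 : EuclideanSpace ℝ (Fin n)) ∈ frontier K) :
    (Module.finrank ℝ (Submodule.span ℝ (normalCone K 0)) : ℝ) < ((n : ℝ) + 1) / 2 := by
  obtain ⟨hKc, hKconv, hKint, hK0⟩ := hK
  obtain ⟨hs0, hsω⟩ := hsol
  by_contra! hcon
  set k := Module.finrank ℝ (Submodule.span ℝ (normalCone K 0)) with hk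
  have hkn : k ≤ n := by
    have := Submodule.finrank_le (Submodule.span ℝ (normalCone K 0))
    simpa using this
  obtain ⟨m, hkm⟩ := Nat.exists_eq_add_of_le hkn
  have hkm' : m + 1 ≤ k := by
    have h1 : (n : ℝ) + 1 ≤ 2 * k := by linarith
    have h2 : n + 1 ≤ 2 * k := by exact_mod_cast h1
    omega
  obtain ⟨b, i0, δ, hδ, hN⟩ := adapted_basis (normalCone K 0) normalCone_convex
    zero_mem_normalCone smul_mem_normalCone k m rfl (by omega) (by simpa using hkm)
  obtain ⟨R, hR0, hR⟩ : ∃ R : ℝ, 0 < R ∧ ∀ x ∈ K, ‖x‖ ≤ R := by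
    obtain ⟨R, hR⟩ := hKc.isBounded.exists_norm_le
    exact ⟨max R 1, by positivity, fun x hx => (hR x hx).trans (le_max_left _ _)⟩
  have hcont := suppFn_continuous hKc ⟨0, hK0⟩ hR0.le hR
  have hnpos : (0 : ℝ) < n := by exact_mod_cast (by omega : 0 < n)
  have hn1 : (1 : ℝ) ≤ n := by exact_mod_cast (by omega : 1 ≤ n)
  set η : ℝ := min (1 / n) (δ / (6 * n)) with hη
  have hη0 : 0 < η := by positivity
  have hηδ : 6 * n * η ≤ δ := by
    have : η ≤ δ / (6 * n) := min_le_right _ _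
    rw [le_div_iff₀ (by positivity)] at this
    linarith
  have hηn : n * η ≤ 1 := by
    have : η ≤ 1 / n := min_le_left _ _
    rw [le_div_iff₀ (by positivity)] at this
    linarith
  have hcard : ((Fintype.card (Fin k ⊕ Fin m) : ℕ) : ℝ) = n := by
    rw [hkm]; simp
  set A : ℝ≥0∞ := ((Fintype.card (Fin k ⊕ Fin m) : ℝ≥0) : ℝ≥0∞) ^ ((n : ℝ) - 1) with hA
  have hAtop : A ≠ ⊤ := ENNReal.rpow_ne_top_of_nonneg (by linarith) ENNReal.coe_ne_top
  set D : ℝ := δ / (4 * n * R) + 1 / (2 * R) with hD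
  have hD0 : 0 < D := by positivity
  set B : ℝ := (4 * n * R / δ) ^ k * (2 * R) ^ m with hB
  have hB0 : 0 < B := by positivity
  set c : ℝ := (2 * η) ^ k * 2 ^ m / (2 * η) with hc
  have hc0 : 0 < c := by positivity
  -- the key inequality
  have key : ∀ t : ℝ, 0 < t → t ≤ η →
      n * τ1 * (n * R) ^ (p - 1) * c * t ^ (p - 1) ≤ n * (2 * (A.toReal * (D * B))) := by
    intro t ht htη
    have ht1 : t ≤ 1 := by nlinarith
    set s : Fin k ⊕ Fin m → ℝ := Sum.elim (fun _ => η) (fun _ => t) with hs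
    have hs0' : ∀ j, 0 ≤ s j := by rintro (j | j) <;> simp [hs, hη0.le, ht.le]
    have hsη : ∀ j, s j ≤ η := by rintro (j | j) <;> simp [hs, htη]
    set cap : Set (EuclideanSpace ℝ (Fin n)) :=
      {u | ‖u‖ = 1 ∧ 0 ≤ b.repr u (Sum.inl i0) ∧ ∀ j, j ≠ Sum.inl i0 → |b.repr u j| ≤ s j}
      with hcap
    have hsum : ∑ j : {j // j ≠ (Sum.inl i0 : Fin k ⊕ Fin m)}, s j ^ 2 ≤ 1 := by
      calc _ ≤ ∑ j : {j // j ≠ (Sum.inl i0 : Fin k ⊕ Fin m)}, η ^ 2 :=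
            Finset.sum_le_sum fun j _ => by
              have := hs0' j
              have := hsη j
              gcongr
        _ = (Fintype.card {j // j ≠ (Sum.inl i0 : Fin k ⊕ Fin m)} : ℝ) * η ^ 2 := by simp
        _ = ((n : ℝ) - 1) * η ^ 2 := by rw [card_ne_real, hcard]
        _ ≤ 1 := by nlinarith
    have hlow := hausdorff_cap b s hs0' (Sum.inl i0) hsum
    rw [hcard] at hlow
    have hprod : ∏ j : {j // j ≠ (Sum.inl i0 : Fin k ⊕ Fin m)}, (2 * |s j|) = c * t ^ m := by
      have h1 := Fintype.prod_eq_mul_prod_subtype_ne (fun j => 2 * |s j|)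
        (Sum.inl i0 : Fin k ⊕ Fin m)
      rw [Fintype.prod_sum_type] at h1
      simp only [hs, Sum.elim_inl, Sum.elim_inr, abs_of_pos hη0, abs_of_pos ht, Finset.prod_const,
        Finset.card_univ, Fintype.card_fin] at h1
      simp only [hs]
      rw [hc, div_mul_eq_mul_div, eq_div_iff (by positivity), mul_comm, ← h1, mul_pow 2 t]
      ring
    rw [hprod] at hlow
    set ω := cap ∩ {u | 0 < suppFn K u} with hω
    have hωm : MeasurableSet ω := by
      refine MeasurableSet.inter ?_ (isOpen_lt continuous_const hcont).measurableSet
      have h1 : ∀ j, Continuous fun u => b.repr u j := by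
        intro j; simp only [b.repr_apply_apply]; fun_prop
      have h2 : IsClosed cap := by
        rw [hcap]
        simp only [Set.ofPred_and, Set.ofPred_forall]
        refine (isClosed_eq continuous_norm continuous_const).inter
          ((isClosed_le continuous_const (h1 _)).inter ?_)
        exact isClosed_iInter fun j => isClosed_iInter fun _ =>
          isClosed_le (h1 j).abs continuous_const
      exact h2.measurableSet
    have hcapS : ∀ u ∈ cap, u ∈ unitSphere n := by
      intro u hu
      simpa [unitSphere] using hu.1
    have hωS : ω ⊆ {u ∈ unitSphere n | 0 < suppFn K u} := fun u hu => ⟨hcapS u hu.1, hu.2⟩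
    have hh0 : ∀ u, 0 ≤ suppFn K u := fun u => by
      simpa using le_suppFn hKc u hK0
    have hωcap : μH[(n : ℝ) - 1] cap ≤ μH[(n : ℝ) - 1] ω := by
      have : cap ⊆ ω ∪ {u ∈ unitSphere n | suppFn K u = 0} := by
        intro u hu
        rcases (hh0 u).lt_or_eq with h | h
        · exact Or.inl ⟨hu, h⟩
        · exact Or.inr ⟨hcapS u hu, h.symm⟩
      refine (measure_mono this).trans ((measure_union_le _ _).trans ?_)
      rw [hs0, add_zero]
    have hhle : ∀ u ∈ cap, suppFn K u ≤ n * R * t := fun u hu =>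
      suppFn_le ⟨0, hK0⟩ u fun x hx =>
        (cap_estimate hkm b i0 hδ hR0 hR hN hηδ hη0 ht htη hu.1 hu.2.1 hu.2.2 hx).1
    -- lower bound
    have hlower : ENNReal.ofReal (n * τ1 * (n * R * t) ^ (p - 1)) * ENNReal.ofReal (c * t ^ m)
        ≤ surfMeas K ω := by
      rw [hsω ω hωm hωS]
      calc _ ≤ ENNReal.ofReal (n * τ1 * (n * R * t) ^ (p - 1)) * μH[(n : ℝ) - 1] ω := by
            gcongr
            exact hlow.trans hωcap
        _ = ∫⁻ u in ω, ENNReal.ofReal (n * τ1 * (n * R * t) ^ (p - 1)) ∂μH[(n : ℝ) - 1] := by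
            rw [setLIntegral_const]
        _ ≤ _ := by
            refine setLIntegral_mono' hωm fun u hu => ?_
            have h1 := (hf u (hcapS u hu.1)).1.le
            have h2 : (n * R * t) ^ (p - 1) ≤ suppFn K u ^ (p - 1) :=
              Real.rpow_le_rpow_of_nonpos hu.2 (hhle u hu.1) (by linarith)
            have h3 : 0 ≤ (n * R * t) ^ (p - 1) := by positivity
            gcongr
            exact mul_nonneg hnpos.le (hτ1.le.trans h1)
    -- upper bound
    set r : Fin k ⊕ Fin m → ℝ := Sum.elim (fun _ => 2 * n * R * t / δ) (fun _ => R) with hr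
    have hr0 : ∀ j, 0 < r j := by
      rintro (j | j)
      · simp only [hr, Sum.elim_inl]; positivity
      · simpa [hr] using hR0
    have hface : ∀ x ∈ (⋃ u ∈ ω, face K u), ∃ u ∈ ω, x ∈ K ∧ ⟪x, u⟫ = suppFn K u := by
      intro x hx
      simp only [Set.mem_iUnion] at hx
      obtain ⟨u, hu, h1, h2⟩ := hx
      exact ⟨u, hu, h1, h2⟩
    have hupper : surfMeas K ω ≤ ∑ i, μH[(n : ℝ) - 1] (boxFace b r i) := by
      refine hausdorff_convex_surface b r hr0 _ ?_ ?_ (by linarith)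
      · intro x hx j
        obtain ⟨u, hu, hxK, hxu⟩ := hface x hx
        rcases j with j | j
        · refine (cap_estimate hkm b i0 hδ hR0 hR hN hηδ hη0 ht htη hu.1.1 hu.1.2.1 hu.1.2.2
            hxK).2 ?_ j
          rw [real_inner_comm, hxu]; exact hh0 u
        · simp only [hr, Sum.elim_inr]
          rw [b.repr_apply_apply]
          refine (abs_real_inner_le_norm _ _).trans ?_
          rw [b.orthonormal.1, one_mul]
          exact hR x hxK
      · intro x hx
        obtain ⟨u, hu, hxK, hxu⟩ := hface x hx
        refine ⟨u, ?_, ?_⟩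
        · rintro rfl
          have := hu.1.1
          simp at this
        · intro y hy
          obtain ⟨_, _, hyK, _⟩ := hface y hy
          have := le_suppFn hKc u hyK
          rw [inner_sub_right, real_inner_comm x u]
          rw [real_inner_comm] at hxu
          linarith [real_inner_comm x u]
    have hupper2 : ENNReal.ofReal t * surfMeas K ω
        ≤ ENNReal.ofReal (n * (2 * (A.toReal * (D * B * t ^ k)))) := by
      calc _ ≤ ENNReal.ofReal t * ∑ i, μH[(n : ℝ) - 1] (boxFace b r i) := by gcongr
        _ = ∑ i, ENNReal.ofReal t * μH[(n : ℝ) - 1] (boxFace b r i) := Finset.mul_sum _ _ _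
        _ ≤ ∑ i : Fin k ⊕ Fin m, ENNReal.ofReal (2 * (A.toReal * (D * B * t ^ k))) := by
            refine Finset.sum_le_sum fun i _ => ?_
            have h1 := hausdorff_face b r (fun j => (hr0 j).le) i
            rw [hcard] at h1
            have h2 : t * ∏ j : {j // j ≠ i}, (2 * |r j|) ≤ D * B * t ^ k := by
              have h3 := Fintype.prod_eq_mul_prod_subtype_ne (fun j => 2 * |r j|) i
              have h4 : ∏ j, (2 * |r j|) = B * t ^ k := by
                have h5 : 0 < 2 * n * R * t / δ := by positivity
                rw [Fintype.prod_sum_type]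
                simp only [hr, Sum.elim_inl, Sum.elim_inr, abs_of_pos h5, abs_of_pos hR0,
                  Finset.prod_const, Finset.card_univ, Fintype.card_fin]
                rw [hB, show 2 * (2 * n * R * t / δ) = (4 * n * R / δ) * t by ring, mul_pow _ t]
                ring
              have h6 : t ≤ D * (2 * |r i|) := by
                rw [abs_of_pos (hr0 i)]
                rcases i with i | i
                · simp only [hr, Sum.elim_inl]
                  have : D * (2 * (2 * n * R * t / δ)) = t + 1 / (2 * R) * (2 * (2 * n * R * t / δ)) := by
                    rw [hD, add_mul]; congr 1; field_simp; ring
                  rw [this]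
                  have : 0 ≤ 1 / (2 * R) * (2 * (2 * n * R * t / δ)) := by positivity
                  linarith
                · simp only [hr, Sum.elim_inr]
                  have : D * (2 * R) = 1 + δ / (4 * n * R) * (2 * R) := by
                    rw [hD]; field_simp; ring
                  rw [this]
                  have : 0 ≤ δ / (4 * n * R) * (2 * R) := by positivity
                  linarith
              have h7 : 0 ≤ ∏ j : {j // j ≠ i}, (2 * |r j|) :=
                Finset.prod_nonneg fun j _ => by positivity
              calc _ ≤ D * (2 * |r i|) * ∏ j : {j // j ≠ i}, (2 * |r j|) := by gcongr
                _ = D * B * t ^ k := by rw [mul_assoc, ← h3, h4, ← mul_assoc]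
            calc _ ≤ ENNReal.ofReal t *
                  (2 * (A * ENNReal.ofReal (∏ j : {j // j ≠ i}, (2 * |r j|)))) := by gcongr
              _ = 2 * (A * ENNReal.ofReal (t * ∏ j : {j // j ≠ i}, (2 * |r j|))) := by
                  rw [ENNReal.ofReal_mul ht.le]; ring
              _ ≤ 2 * (A * ENNReal.ofReal (D * B * t ^ k)) := by gcongr
              _ = _ := by
                  rw [ENNReal.ofReal_mul (p := 2) (by norm_num),
                    ENNReal.ofReal_mul (p := A.toReal) ENNReal.toReal_nonneg,
                    ENNReal.ofReal_toReal hAtop]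
                  norm_num
        _ = _ := by
            rw [Finset.sum_const, Finset.card_univ, nsmul_eq_mul, ENNReal.ofReal_mul hnpos.le,
              ← hcard, ENNReal.ofReal_natCast]
    have hfin : ENNReal.ofReal (t * (n * τ1 * (n * R * t) ^ (p - 1) * (c * t ^ m)))
        ≤ ENNReal.ofReal (n * (2 * (A.toReal * (D * B * t ^ k)))) := by
      refine le_trans ?_ hupper2
      rw [ENNReal.ofReal_mul ht.le, ENNReal.ofReal_mul (by positivity)]
      gcongr
    have hA0 : 0 ≤ A.toReal := ENNReal.toReal_nonneg
    have hreal := (ENNReal.ofReal_le_ofReal_iff (by positivity)).1 hfin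
    have htk : t ^ k ≤ t ^ (m + 1) := pow_le_pow_of_le_one ht.le ht1 hkm'
    have hreal2 : n * (2 * (A.toReal * (D * B * t ^ k))) ≤
        n * (2 * (A.toReal * (D * B * t ^ (m + 1)))) := by gcongr
    rw [Real.mul_rpow (by positivity) ht.le] at hreal
    have htm : 0 < t ^ (m + 1) := by positivity
    refine le_of_mul_le_mul_right ?_ htm
    calc _ = t * (n * τ1 * ((n * R) ^ (p - 1) * t ^ (p - 1)) * (c * t ^ m)) := by ring
      _ ≤ _ := hreal.trans hreal2
      _ = _ := by ring
  have hlim := tendsto_rpow_neg_nhdsGT_zero (y := p - 1) (by linarith)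
  set Q : ℝ := n * τ1 * (n * R) ^ (p - 1) * c with hQ
  have hQ0 : 0 < Q := by positivity
  have hev := (hlim.eventually_gt_atTop (n * (2 * (A.toReal * (D * B))) / Q)).and
    (Ioc_mem_nhdsGT hη0)
  obtain ⟨t, ht1, ht2⟩ := hev.exists
  have := key t ht2.1 ht2.2
  rw [div_lt_iff₀ hQ0] at ht1
  linarith
end
end

section
/- Let n ≥ 2, let r ≥ 2 be an integer, let p < min{1, 2r − n}, and let 0 < τ1 < τ2. Suppose f : S^{n-1} → ℝ satisfies τ1 < f(u) < τ2 for all u ∈ S^{n-1}, and K ∈ K_0^n is a solution of the L_p Minkowski problem dS_{K,p} = f dH^{n-1} with o ∈ ∂K. Then the dimension of the linear span of the normal cone N(K,o) is strictly less than r. -/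
open MeasureTheory Set
open scoped ENNReal NNReal RealInnerProductSpace

noncomputable section

lemma zero_mem_nc {n : ℕ} (K : Set (EuclideanSpace ℝ (Fin n))) : (0:EuclideanSpace ℝ (Fin n)) ∈ normalCone K 0 := by
  intro y hy; simp

lemma exists_inner_pt {n : ℕ} (K : Set (EuclideanSpace ℝ (Fin n)))
    (L : Submodule ℝ (EuclideanSpace ℝ (Fin n))) (hL : L = Submodule.span ℝ (normalCone K 0))
    (hd : 0 < Module.finrank ℝ L) :
    ∃ u : L, ‖u‖ = 1 ∧ ∃ ρ > 0, ∀ v : L, ‖v - u‖ < ρ →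
      (v : EuclideanSpace ℝ (Fin n)) ∈ normalCone K 0 := by
  set N : Set L := {x | (x : EuclideanSpace ℝ (Fin n)) ∈ normalCone K 0} with hN
  have hcone : ∀ t : ℝ, 0 ≤ t → ∀ x ∈ N, t • x ∈ N := by
    intro t ht x hx y hy
    have := hx y hy
    simp only [inner_zero_right, Submodule.coe_smul, inner_smul_left] at this ⊢
    simpa using mul_nonpos_of_nonneg_of_nonpos ht this
  have hconv : Convex ℝ N := by
    intro x hx y hy a b ha hb hab z hz
    have h1 := hcone a ha x hx z hz
    have h2 := hcone b hb y hy z hz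
    simp only [inner_zero_right, Submodule.coe_add, inner_add_left] at *
    linarith
  have himg : (Subtype.val '' N : Set (EuclideanSpace ℝ (Fin n))) = normalCone K 0 := by
    ext x; constructor
    · rintro ⟨y, hy, rfl⟩; exact hy
    · intro hx; exact ⟨⟨x, hL ▸ Submodule.subset_span hx⟩, hx, rfl⟩
  have hspan : Submodule.span ℝ N = ⊤ := by
    have h : Submodule.map L.subtype (Submodule.span ℝ N) = Submodule.map L.subtype ⊤ := by
      rw [Submodule.map_span, Submodule.map_top, Submodule.range_subtype]
      change Submodule.span ℝ (Subtype.val '' N) = L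
      rw [himg, hL]
    exact Submodule.map_injective_of_injective L.injective_subtype h
  have h0 : (0 : L) ∈ N := by simpa [hN] using zero_mem_nc K
  have haff : affineSpan ℝ N = ⊤ := by
    have h := affineSpan_insert_zero (k := ℝ) N
    rw [insert_eq_of_mem h0, hspan] at h
    exact SetLike.coe_injective (by simpa using h)
  have hint := hconv.interior_nonempty_iff_affineSpan_eq_top.2 haff
  have : Nontrivial L := Module.finrank_pos_iff.1 hd
  obtain ⟨u, hu, hu0⟩ : ∃ u ∈ interior N, u ≠ 0 := by
    obtain ⟨u, hu⟩ := (dense_compl_singleton (0:L)).inter_open_nonempty _ isOpen_interior hint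
    exact ⟨u, hu.1, hu.2⟩
  obtain ⟨ρ, hρ, hball⟩ := Metric.isOpen_iff.1 isOpen_interior u hu
  have hun : 0 < ‖u‖ := norm_pos_iff.2 hu0
  refine ⟨‖u‖⁻¹ • u, by rw [norm_smul, norm_inv, norm_norm, inv_mul_cancel₀ hun.ne'], ρ / ‖u‖, by positivity, fun v hv => ?_⟩
  have h1 : ‖u‖ • v ∈ N := by
    apply interior_subset
    apply hball
    rw [mem_ball_iff_norm]
    have : ‖u‖ • v - u = ‖u‖ • (v - ‖u‖⁻¹ • u) := by
      rw [smul_sub, smul_smul, mul_inv_cancel₀ hun.ne', one_smul]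
    rw [this, norm_smul, norm_norm]
    rwa [lt_div_iff₀' hun] at hv
  have h2 := hcone (‖u‖⁻¹) (by positivity) _ h1
  rwa [smul_smul, inv_mul_cancel₀ hun.ne', one_smul] at h2

lemma exists_frame {m : ℕ} (K : Set (EuclideanSpace ℝ (Fin (m+1))))
    (hd : 0 < Module.finrank ℝ (Submodule.span ℝ (normalCone K 0))) :
    ∃ B : OrthonormalBasis (Fin (m+1)) ℝ (EuclideanSpace ℝ (Fin (m+1))), ∃ S : Finset (Fin m),
      S.card + 1 = Module.finrank ℝ (Submodule.span ℝ (normalCone K 0)) ∧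
      ∃ η > 0, ∀ v, 1/2 ≤ ⟪B 0, v⟫ → (∀ j ∈ S, |⟪B j.succ, v⟫| ≤ 2 * η) →
        (∀ j ∉ S, ⟪B j.succ, v⟫ = 0) → v ∈ normalCone K 0 := by
  obtain ⟨L, hL⟩ : ∃ L, L = Submodule.span ℝ (normalCone K 0) := ⟨_, rfl⟩
  rw [← hL] at hd ⊢
  obtain ⟨u, hu, ρ, hρ, hball⟩ := exists_inner_pt K L hL hd
  obtain ⟨d, hdd⟩ : ∃ d, d = Module.finrank ℝ L := ⟨_, rfl⟩
  rw [← hdd] at hd ⊢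
  have hdm : d ≤ m + 1 := by
    rw [hdd]; simpa using Submodule.finrank_le L
  obtain ⟨b, hb⟩ := Orthonormal.exists_orthonormalBasis_extension_of_card_eq (𝕜 := ℝ) (E := L)
    (ι := Fin d) (by simp [hdd]) (v := fun _ => u) (s := {⟨0, hd⟩}) (by
      constructor
      · intro i; simpa using hu
      · intro i j hij; exact (hij (Subsingleton.elim _ _)).elim)
  obtain ⟨B, hB⟩ := Orthonormal.exists_orthonormalBasis_extension_of_card_eq (𝕜 := ℝ)
    (E := EuclideanSpace ℝ (Fin (m+1))) (ι := Fin (m+1)) (by simp)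
    (v := fun i => if h : i.val < d then (b ⟨i, h⟩ : EuclideanSpace ℝ (Fin (m+1))) else 0)
    (s := {i | i.val < d}) (by
      have := b.orthonormal.comp (fun i : {i : Fin (m+1) | i.val < d} => ⟨i.1.1, i.2⟩) (by
        intro i j hij
        simp only [Fin.mk.injEq] at hij
        exact Subtype.ext (Fin.ext hij))
      have h2 := this.comp_linearIsometry L.subtypeₗᵢ
      refine (congrArg (Orthonormal ℝ) (funext fun i => ?_)).mpr h2
      have hi : i.1.1 < d := i.2
      simp [hi])
  have hBL : ∀ i : Fin (m+1), i.val < d → B i ∈ L := by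
    intro i hi
    rw [hB i hi]; simp [hi]
  have hB0 : B 0 = u := by
    rw [hB 0 (by simpa using hd)]
    have := hb ⟨0, hd⟩ rfl
    simp [hd, this]
  refine ⟨B, Finset.univ.filter (fun j => j.succ.val < d), ?_, ρ / (4 * (m + 1)), by positivity, ?_⟩
  · have : (Finset.univ.filter (fun j : Fin m => j.succ.val < d)) =
        Finset.univ.filter (fun j : Fin m => j.val < d - 1) := by
      ext j; simp; omega
    rw [this, Fin.card_filter_val_lt]
    omega
  · intro v hv0 hvS hvN
    set s := ⟪B 0, v⟫ with hs
    have hs0 : 0 < s := by linarith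
    have hsum : v = s • B 0 + ∑ j : Fin m, ⟪B j.succ, v⟫ • B j.succ := by
      conv_lhs => rw [← B.sum_repr' v, Fin.sum_univ_succ]
    have hvL : v ∈ L := by
      rw [hsum]
      refine L.add_mem (L.smul_mem _ (hBL 0 (by simpa using hd))) (L.sum_mem fun j _ => ?_)
      by_cases hj : j.succ.val < d
      · exact L.smul_mem _ (hBL _ hj)
      · rw [hvN j (by simpa using hj)]; simp
    have hmem := hball (s⁻¹ • ⟨v, hvL⟩) (by
      rw [← Submodule.norm_coe]
      have e : ((s⁻¹ • (⟨v, hvL⟩ : L) - u : L) : EuclideanSpace ℝ (Fin (m+1)))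
          = ∑ j : Fin m, (s⁻¹ * ⟪B j.succ, v⟫) • B j.succ := by
        simp only [Submodule.coe_sub, Submodule.coe_smul]
        conv_lhs => rw [hsum]
        rw [smul_add, smul_smul, inv_mul_cancel₀ hs0.ne', one_smul, hB0, Finset.smul_sum]
        simp [smul_smul]
      rw [e]
      have hsi : s⁻¹ ≤ 2 := by
        rw [inv_le_comm₀ hs0 (by norm_num)]; linarith
      calc _ ≤ ∑ j : Fin m, ρ / (m+1) := by
            refine norm_sum_le_of_le _ fun j _ => ?_
            rw [norm_smul, B.norm_eq_one, mul_one, norm_mul, Real.norm_eq_abs, Real.norm_eq_abs,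
              abs_of_pos (inv_pos.2 hs0)]
            have : |⟪B j.succ, v⟫| ≤ 2 * (ρ / (4 * (m + 1))) := by
              by_cases hj : j.succ.val < d
              · exact hvS j (by simpa using hj)
              · rw [hvN j (by simpa using hj)]; simp; positivity
            calc _ ≤ 2 * (2 * (ρ / (4 * (m + 1)))) := by gcongr
              _ = _ := by field_simp; norm_num
        _ = m * (ρ / (m+1)) := by simp
        _ < ρ := by
            rw [mul_div_assoc', div_lt_iff₀ (by positivity)]
            nlinarith)
    intro y hy
    have := hmem y hy
    simp only [inner_zero_right, Submodule.coe_smul, inner_smul_left] at this ⊢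
    have h3 : s⁻¹ * ⟪v, y⟫ ≤ 0 := by simpa using this
    exact nonpos_of_mul_nonpos_right h3 (inv_pos.2 hs0)

lemma core_le {m : ℕ} {K : Set (EuclideanSpace ℝ (Fin (m+1)))} {R : ℝ}
    (hR : ∀ y ∈ K, ‖y‖ ≤ R)
    (B : OrthonormalBasis (Fin (m+1)) ℝ (EuclideanSpace ℝ (Fin (m+1)))) (S : Finset (Fin m))
    {η : ℝ} (hN : ∀ v, 1/2 ≤ ⟪B 0, v⟫ → (∀ j ∈ S, |⟪B j.succ, v⟫| ≤ 2 * η) →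
        (∀ j ∉ S, ⟪B j.succ, v⟫ = 0) → v ∈ normalCone K 0)
    {ε : ℝ} (hε : 0 < ε) (u : EuclideanSpace ℝ (Fin (m+1)))
    (h0 : 1/2 ≤ ⟪B 0, u⟫) (hS : ∀ j ∈ S, |⟪B j.succ, u⟫| < η)
    (hS' : ∀ j ∉ S, |⟪B j.succ, u⟫| < ε) (w : EuclideanSpace ℝ (Fin (m+1)))
    (hw0 : ⟪B 0, w⟫ = 0) (hwS : ∀ j ∈ S, |⟪B j.succ, w⟫| ≤ η)
    (hwS' : ∀ j ∉ S, ⟪B j.succ, w⟫ = 0) (y : EuclideanSpace ℝ (Fin (m+1))) (hy : y ∈ K) :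
    ⟪u, y⟫ + ⟪w, y⟫ ≤ m * (ε * R) := by
  classical
  set q : EuclideanSpace ℝ (Fin (m+1)) := ∑ j ∈ Sᶜ, ⟪B j.succ, u⟫ • B j.succ with hq
  have hB : ∀ i j, ⟪B i, B j⟫ = if i = j then (1:ℝ) else 0 := by
    intro i j; exact orthonormal_iff_ite.1 B.orthonormal i j
  have hq0 : ⟪B 0, q⟫ = 0 := by
    rw [hq, inner_sum]
    refine Finset.sum_eq_zero fun j _ => ?_
    rw [inner_smul_right, hB, if_neg (Fin.succ_ne_zero j).symm, mul_zero]
  have hqj : ∀ i : Fin m, ⟪B i.succ, q⟫ = if i ∈ S then 0 else ⟪B i.succ, u⟫ := by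
    intro i
    rw [hq, inner_sum]
    simp only [inner_smul_right, hB, Fin.succ_inj, mul_ite, mul_one, mul_zero]
    rw [Finset.sum_ite_eq]
    simp only [Finset.mem_compl]
    split_ifs <;> rfl
  have hv := hN (u + w - q) (by
      rw [inner_sub_right, inner_add_right, hq0, hw0]; linarith) (by
      intro j hj
      rw [inner_sub_right, inner_add_right, hqj, if_pos hj, sub_zero]
      have := abs_add_le ⟪B j.succ, u⟫ ⟪B j.succ, w⟫
      have := hS j hj
      have := hwS j hj
      linarith) (by
      intro j hj
      rw [inner_sub_right, inner_add_right, hqj, if_neg hj, hwS' j hj]; ring) y hy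
  rw [inner_zero_right, inner_sub_left, inner_add_left] at hv
  have hqy : ⟪q, y⟫ ≤ m * (ε * R) := by
    rw [hq, sum_inner]
    have hR0 : 0 ≤ R := (norm_nonneg y).trans (hR y hy)
    calc _ ≤ ∑ j ∈ Sᶜ, ε * R := by
          refine Finset.sum_le_sum fun j hj => ?_
          rw [inner_smul_left]
          have h1 := hS' j (by simpa using hj)
          have h2 := abs_real_inner_le_norm (B j.succ) y
          rw [B.norm_eq_one, one_mul] at h2
          have h3 := h2.trans (hR y hy)
          refine (le_abs_self _).trans ?_
          rw [abs_mul]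
          simp only [conj_trivial]
          gcongr
      _ = (Sᶜ.card : ℝ) * (ε * R) := by simp
      _ ≤ m * (ε * R) := by
          have : Sᶜ.card ≤ m := by simpa using Finset.card_le_univ Sᶜ
          gcongr
  linarith

lemma bddAbove_im {n : ℕ} {K : Set (EuclideanSpace ℝ (Fin n))} {R : ℝ}
    (hR : ∀ y ∈ K, ‖y‖ ≤ R) (u : EuclideanSpace ℝ (Fin n)) :
    BddAbove ((fun y => ⟪u, y⟫) '' K) := by
  refine ⟨‖u‖ * R, ?_⟩
  rintro _ ⟨y, hy, rfl⟩
  exact (real_inner_le_norm u y).trans (by gcongr; exact hR y hy)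

/-- the (n-1) coordinates -/
def proj {m : ℕ} (B : OrthonormalBasis (Fin (m+1)) ℝ (EuclideanSpace ℝ (Fin (m+1))))
    (z : EuclideanSpace ℝ (Fin (m+1))) : Fin m → ℝ := fun j => ⟪B j.succ, z⟫

lemma proj_lip {m : ℕ} (B : OrthonormalBasis (Fin (m+1)) ℝ (EuclideanSpace ℝ (Fin (m+1)))) :
    LipschitzWith 1 (proj B) := by
  refine LipschitzWith.of_dist_le_mul fun x y => ?_
  rw [dist_pi_le_iff (by positivity)]
  intro j
  rw [NNReal.coe_one, one_mul, Real.dist_eq, proj, proj, ← inner_sub_right, dist_eq_norm]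
  have := abs_real_inner_le_norm (B j.succ) (x - y)
  rwa [B.norm_eq_one, one_mul] at this

lemma lower_meas {m : ℕ} (B : OrthonormalBasis (Fin (m+1)) ℝ (EuclideanSpace ℝ (Fin (m+1))))
    (a : Fin m → ℝ) (ha : ∀ j, a j ^ 2 * (4 * (m + 1)) ≤ 1) :
    (∏ j, ENNReal.ofReal (2 * a j)) ≤
      μH[((m+1 : ℕ) : ℝ) - 1] {u ∈ unitSphere (m+1) | 1/2 ≤ ⟪B 0, u⟫ ∧ ∀ j, |⟪B j.succ, u⟫| < a j} := by
  have h := (proj_lip B).hausdorffMeasure_image_le (d := ((m+1 : ℕ) : ℝ) - 1) (by simp)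
    {u ∈ unitSphere (m+1) | 1/2 ≤ ⟪B 0, u⟫ ∧ ∀ j, |⟪B j.succ, u⟫| < a j}
  rw [ENNReal.coe_one, ENNReal.one_rpow, one_mul] at h
  refine le_trans ?_ h
  have e : (((m+1 : ℕ) : ℝ) - 1) = (Fintype.card (Fin m) : ℝ) := by simp
  rw [e, hausdorffMeasure_pi_real]
  have hv : volume (Set.pi univ fun j => Ioo (- a j) (a j)) = ∏ j, ENNReal.ofReal (2 * a j) := by
    rw [Real.volume_pi_Ioo]; congr 1; ext j; congr 1; ring
  rw [← hv]
  refine measure_mono fun x hx => ?_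
  have hx' : ∀ j, |x j| < a j := fun j => abs_lt.2 (hx j (mem_univ j))
  have hsum : ∑ j, x j ^ 2 ≤ 1/4 := by
    calc _ ≤ ∑ j : Fin m, 1 / (4 * ((m:ℝ) + 1)) := by
          refine Finset.sum_le_sum fun j _ => ?_
          rw [le_div_iff₀ (by positivity)]
          refine le_trans ?_ (ha j)
          have := sq_le_sq' (by linarith [(abs_lt.1 (hx' j)).1]) (abs_lt.1 (hx' j)).2.le
          gcongr
      _ ≤ 1/4 := by
          simp only [Finset.sum_const, Finset.card_univ, Fintype.card_fin, nsmul_eq_mul]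
          rw [mul_one_div, div_le_div_iff₀ (by positivity) (by positivity)]
          linarith
  set c := √(1 - ∑ j, x j ^ 2) with hc
  have hc2 : c ^ 2 = 1 - ∑ j, x j ^ 2 := Real.sq_sqrt (by linarith)
  have hc1 : 1/2 ≤ c := Real.le_sqrt_of_sq_le (by linarith)
  have hr : ∀ i, ⟪B i, B.repr.symm (WithLp.toLp 2 (Fin.cons c x : Fin (m+1) → ℝ))⟫ = (Fin.cons c x : Fin (m+1) → ℝ) i := by
    intro i
    rw [← B.repr_apply_apply]; simp
  refine ⟨B.repr.symm (WithLp.toLp 2 (Fin.cons c x : Fin (m+1) → ℝ)), ⟨?_, ?_, ?_⟩, ?_⟩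
  · rw [unitSphere, mem_sphere_zero_iff_norm, LinearIsometryEquiv.norm_map, EuclideanSpace.norm_eq,
      Fin.sum_univ_succ]
    simp [hc2]
  · rw [hr]; simpa using hc1
  · intro j; rw [hr]; simpa using hx' j
  · ext j; rw [proj, hr]; simp

lemma upper_meas {m : ℕ} (B : OrthonormalBasis (Fin (m+1)) ℝ (EuclideanSpace ℝ (Fin (m+1))))
    {K : Set (EuclideanSpace ℝ (Fin (m+1)))} {R : ℝ} (hR : ∀ y ∈ K, ‖y‖ ≤ R)
    (ω : Set (EuclideanSpace ℝ (Fin (m+1)))) (hω : ω ⊆ unitSphere (m+1))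
    (hω0 : ∀ u ∈ ω, 1/2 ≤ ⟪B 0, u⟫) (a : Fin m → ℝ)
    (ha : ∀ u ∈ ω, ∀ z ∈ face K u, ∀ j, |⟪B j.succ, z⟫| ≤ a j) :
    surfMeas K ω ≤ ((3 * m : ℝ≥0) : ℝ≥0∞) ^ (m:ℝ) * ∏ j, ENNReal.ofReal (2 * a j) := by
  set Z := ⋃ u ∈ ω, face K u with hZ
  have key : ∀ z ∈ Z, ∀ z' ∈ Z, ⟪B 0, z - z'⟫ ≤ 2 * (m * dist (proj B z) (proj B z')) := by
    intro z hz z' hz'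
    simp only [hZ, mem_iUnion] at hz hz'
    obtain ⟨u, hu, hz⟩ := hz
    obtain ⟨u', hu', hz'⟩ := hz'
    have h1 : ⟪u', z⟫ ≤ ⟪u', z'⟫ := by
      rw [real_inner_comm z', hz'.2]
      exact le_csSup (bddAbove_im hR u') ⟨z, hz.1, rfl⟩
    have h2 : ⟪u', z - z'⟫ ≤ 0 := by rw [inner_sub_right]; linarith
    rw [← B.sum_inner_mul_inner, Fin.sum_univ_succ] at h2
    have h3 : -(∑ j : Fin m, ⟪u', B j.succ⟫ * ⟪B j.succ, z - z'⟫) ≤ m * dist (proj B z) (proj B z') := by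
      refine (neg_le_abs _).trans ((Finset.abs_sum_le_sum_abs _ _).trans ?_)
      calc _ ≤ ∑ j : Fin m, dist (proj B z) (proj B z') := by
            refine Finset.sum_le_sum fun j _ => ?_
            rw [abs_mul]
            have h4 := abs_real_inner_le_norm u' (B j.succ)
            have h5 : ‖u'‖ = 1 := mem_sphere_zero_iff_norm.1 (hω hu')
            rw [B.norm_eq_one, h5, one_mul] at h4
            have h6 := dist_le_pi_dist (proj B z) (proj B z') j
            rw [Real.dist_eq, proj, proj, ← inner_sub_right] at h6
            calc _ ≤ 1 * |⟪B j.succ, z - z'⟫| := by gcongr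
              _ ≤ _ := by rw [one_mul]; exact h6
        _ = _ := by simp
    have h7 := hω0 u' hu'
    rw [real_inner_comm] at h7
    by_cases h8 : ⟪B 0, z - z'⟫ ≤ 0
    · exact h8.trans (by positivity)
    · push Not at h8
      have := mul_le_mul_of_nonneg_right h7 h8.le
      linarith
  have key2 : ∀ z ∈ Z, ∀ z' ∈ Z, dist z z' ≤ 3 * m * dist (proj B z) (proj B z') := by
    intro z hz z' hz'
    have h1 := key z hz z' hz'
    have h2 := key z' hz' z hz
    rw [← neg_sub, inner_neg_right, dist_comm] at h2
    have h3 : |⟪B 0, z - z'⟫| ≤ 2 * (m * dist (proj B z) (proj B z')) := abs_le.2 ⟨by linarith, h1⟩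
    rw [dist_eq_norm, ← B.sum_repr' (z - z'), Fin.sum_univ_succ]
    refine (norm_add_le _ _).trans ?_
    have h4 : ‖∑ j : Fin m, ⟪B j.succ, z - z'⟫ • B j.succ‖ ≤ m * dist (proj B z) (proj B z') := by
      calc _ ≤ ∑ j : Fin m, dist (proj B z) (proj B z') := by
            refine norm_sum_le_of_le _ fun j _ => ?_
            rw [norm_smul, B.norm_eq_one, mul_one, Real.norm_eq_abs]
            have h6 := dist_le_pi_dist (proj B z) (proj B z') j
            rwa [Real.dist_eq, proj, proj, ← inner_sub_right] at h6
        _ = _ := by simp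
    have h5 : ‖⟪B 0, z - z'⟫ • B 0‖ ≤ 2 * (m * dist (proj B z) (proj B z')) := by
      rw [norm_smul, B.norm_eq_one, mul_one, Real.norm_eq_abs]; exact h3
    linarith
  have hinj : InjOn (proj B) Z := by
    intro z hz z' hz' h
    have := key2 z hz z' hz'
    rw [h, dist_self, mul_zero] at this
    exact dist_le_zero.1 this
  have hleft := hinj.leftInvOn_invFunOn
  have hlip : LipschitzOnWith (3 * m : ℝ≥0) (Function.invFunOn (proj B) Z) (proj B '' Z) := by
    refine LipschitzOnWith.of_dist_le_mul ?_
    rintro _ ⟨z, hz, rfl⟩ _ ⟨z', hz', rfl⟩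
    rw [hleft hz, hleft hz']
    simpa using key2 z hz z' hz'
  have h := hlip.hausdorffMeasure_image_le (d := (m:ℝ)) (by positivity)
  rw [hleft.image_image] at h
  have e : (((m+1 : ℕ) : ℝ) - 1) = (m : ℝ) := by simp
  have e2 : (m : ℝ) = (Fintype.card (Fin m) : ℝ) := by simp
  rw [surfMeas, e]
  refine h.trans ?_
  gcongr
  have hv : volume (Set.Icc (fun j => - a j) a) = ∏ j, ENNReal.ofReal (2 * a j) := by
    rw [Real.volume_Icc_pi]; congr 1; ext j; congr 1; ring
  have e3 : (μH[(m:ℝ)] : Measure (Fin m → ℝ)) = volume := by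
    rw [e2, hausdorffMeasure_pi_real]
  rw [e3, ← hv]
  refine measure_mono ?_
  rintro _ ⟨z, hz, rfl⟩
  simp only [hZ, mem_iUnion] at hz
  obtain ⟨u, hu, hz⟩ := hz
  exact ⟨fun j => (abs_le.1 (ha u hu z hz j)).1, fun j => (abs_le.1 (ha u hu z hz j)).2⟩

lemma suppFn_pos_iff {n : ℕ} {K : Set (EuclideanSpace ℝ (Fin n))} {R : ℝ}
    (hR : ∀ y ∈ K, ‖y‖ ≤ R) (h0 : (0 : EuclideanSpace ℝ (Fin n)) ∈ K)
    (u : EuclideanSpace ℝ (Fin n)) : 0 < suppFn K u ↔ ∃ y ∈ K, 0 < ⟪u, y⟫ := by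
  constructor
  · intro h
    obtain ⟨_, ⟨y, hy, rfl⟩, h2⟩ := exists_lt_of_lt_csSup (Set.Nonempty.image _ ⟨0, h0⟩) h
    exact ⟨y, hy, h2⟩
  · rintro ⟨y, hy, h⟩
    exact h.trans_le (le_csSup (bddAbove_im hR u) ⟨y, hy, rfl⟩)

lemma suppFn_nonneg {n : ℕ} {K : Set (EuclideanSpace ℝ (Fin n))} {R : ℝ}
    (hR : ∀ y ∈ K, ‖y‖ ≤ R) (h0 : (0 : EuclideanSpace ℝ (Fin n)) ∈ K)
    (u : EuclideanSpace ℝ (Fin n)) : 0 ≤ suppFn K u :=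
  le_csSup (bddAbove_im hR u) ⟨0, h0, by simp⟩

lemma prod_box {m : ℕ} (S : Finset (Fin m)) [DecidableEq (Fin m)] {x y : ℝ} (hx : 0 ≤ x) (hy : 0 ≤ y) :
    ∏ j, ENNReal.ofReal (2 * (if j ∈ S then x else y)) =
      ENNReal.ofReal ((2 * x) ^ S.card * (2 * y) ^ Sᶜ.card) := by
  rw [← ENNReal.ofReal_prod_of_nonneg (by intro j _; split_ifs <;> positivity)]
  congr 1
  rw [← Finset.prod_mul_prod_compl S]
  congr 1
  · rw [Finset.prod_congr rfl (g := fun _ => 2 * x) (by intro j hj; rw [if_pos hj])]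
    simp
  · rw [Finset.prod_congr rfl (g := fun _ => 2 * y)
      (by intro j hj; rw [if_neg (by simpa using hj)])]
    simp

lemma main_ineq {m : ℕ} (hm : 1 ≤ m) {p : ℝ} (hp : p < 1) {τ1 : ℝ} (hτ1 : 0 < τ1)
    {f : EuclideanSpace ℝ (Fin (m+1)) → ℝ} (hf : ∀ u ∈ unitSphere (m+1), τ1 < f u)
    {K : Set (EuclideanSpace ℝ (Fin (m+1)))} {R : ℝ} (hR1 : 1 ≤ R)
    (hR : ∀ y ∈ K, ‖y‖ ≤ R) (h0K : (0 : EuclideanSpace ℝ (Fin (m+1))) ∈ K)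
    (hsol : IsLpSolution p f K)
    (B : OrthonormalBasis (Fin (m+1)) ℝ (EuclideanSpace ℝ (Fin (m+1)))) (S : Finset (Fin m))
    {η : ℝ} (hη : 0 < η) (hη2 : η ^ 2 * (4 * (m + 1)) ≤ 1)
    (hN : ∀ v, 1/2 ≤ ⟪B 0, v⟫ → (∀ j ∈ S, |⟪B j.succ, v⟫| ≤ 2 * η) →
        (∀ j ∉ S, ⟪B j.succ, v⟫ = 0) → v ∈ normalCone K 0)
    {ε : ℝ} (hε : 0 < ε) (hεη : ε ≤ η) :
    (((m + 1 : ℕ) : ℝ) * τ1 * (m * (ε * R)) ^ (p - 1)) * ((2 * η) ^ S.card * (2 * ε) ^ Sᶜ.card) ≤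
      (3 * m : ℝ) ^ (m:ℝ) * ((2 * (m * (ε * R) / η)) ^ S.card * (2 * R) ^ Sᶜ.card) := by
  have hm0 : (0:ℝ) < m := by exact_mod_cast hm
  set M : ℝ := m * (ε * R) with hM
  have hM0 : 0 < M := by positivity
  set a : Fin m → ℝ := fun j => if j ∈ S then η else ε with ha
  set ω₀ : Set (EuclideanSpace ℝ (Fin (m+1))) :=
    {u ∈ unitSphere (m+1) | 1/2 ≤ ⟪B 0, u⟫ ∧ ∀ j, |⟪B j.succ, u⟫| < a j} with hω₀
  set ω := ω₀ ∩ {u | 0 < suppFn K u} with hω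
  have hmeas : MeasurableSet ω := by
    have h1 : IsOpen {u | 0 < suppFn K u} := by
      have : {u | 0 < suppFn K u} = ⋃ y ∈ K, {u : EuclideanSpace ℝ (Fin (m+1)) | 0 < ⟪u, y⟫} := by
        ext u; simp [suppFn_pos_iff hR h0K]
      rw [this]
      exact isOpen_biUnion fun y _ => isOpen_lt (by fun_prop) (by fun_prop)
    refine MeasurableSet.inter ?_ h1.measurableSet
    refine Metric.isClosed_sphere.measurableSet.inter (MeasurableSet.inter ?_ ?_)
    · change MeasurableSet {u : EuclideanSpace ℝ (Fin (m+1)) | 1/2 ≤ ⟪B 0, u⟫}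
      exact (isClosed_le (by fun_prop) (by fun_prop)).measurableSet
    · have : {u : EuclideanSpace ℝ (Fin (m+1)) | ∀ j, |⟪B j.succ, u⟫| < a j}
          = ⋂ j, {u | |⟪B j.succ, u⟫| < a j} := by ext; simp
      change MeasurableSet {u : EuclideanSpace ℝ (Fin (m+1)) | ∀ j, |⟪B j.succ, u⟫| < a j}
      rw [this]
      exact MeasurableSet.iInter fun j => (isOpen_lt (by fun_prop) (by fun_prop)).measurableSet
  have hωS : ∀ u ∈ ω₀, ∀ j ∈ S, |⟪B j.succ, u⟫| < η := by
    intro u hu j hj; have := hu.2.2 j; simpa [ha, hj] using this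
  have hωS' : ∀ u ∈ ω₀, ∀ j ∉ S, |⟪B j.succ, u⟫| < ε := by
    intro u hu j hj; have := hu.2.2 j; simpa [ha, hj] using this
  have hsupp : ∀ u ∈ ω₀, suppFn K u ≤ M := by
    intro u hu
    refine csSup_le ⟨_, 0, h0K, rfl⟩ ?_
    rintro _ ⟨y, hy, rfl⟩
    have := core_le hR B S hN hε u hu.2.1 (hωS u hu) (hωS' u hu) 0 (by simp)
      (by simp [hη.le]) (by simp) y hy
    simpa using this
  have heq := hsol.2 ω hmeas (fun u hu => ⟨hu.1.1, hu.2⟩)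
  have hlow := lower_meas B a (by
    intro j
    refine le_trans ?_ hη2
    have h1 : 0 ≤ a j := by simp only [ha]; split_ifs <;> linarith
    have h2 : a j ≤ η := by simp only [ha]; split_ifs <;> linarith
    gcongr)
  have hlow2 : μH[((m+1 : ℕ) : ℝ) - 1] ω₀ ≤ μH[((m+1 : ℕ) : ℝ) - 1] ω := by
    have : ω₀ ⊆ ω ∪ {u ∈ unitSphere (m+1) | suppFn K u = 0} := by
      intro u hu
      rcases (suppFn_nonneg hR h0K u).lt_or_eq with h | h
      · exact Or.inl ⟨hu, h⟩
      · exact Or.inr ⟨hu.1, h.symm⟩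
    refine (measure_mono this).trans ((measure_union_le _ _).trans ?_)
    rw [hsol.1, add_zero]
  have hint : ENNReal.ofReal (((m + 1 : ℕ) : ℝ) * τ1 * M ^ (p - 1)) * μH[((m+1 : ℕ) : ℝ) - 1] ω ≤
      surfMeas K ω := by
    rw [heq, ← setLIntegral_const]
    refine setLIntegral_mono' hmeas fun u hu => ENNReal.ofReal_le_ofReal ?_
    have h1 := hf u hu.1.1
    have h2 : M ^ (p - 1) ≤ suppFn K u ^ (p - 1) :=
      Real.rpow_le_rpow_of_nonpos hu.2 (hsupp u hu.1) (by linarith)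
    have h3 : 0 ≤ f u := by linarith
    have h4 : 0 ≤ ((m + 1 : ℕ) : ℝ) * f u := by positivity
    gcongr
  have hup := upper_meas B hR ω (fun u hu => hu.1.1) (fun u hu => hu.1.2.1)
    (fun j => if j ∈ S then M / η else R) (by
      intro u hu z hz j
      by_cases hj : j ∈ S
      · simp only [hj, if_true]
        have hBB : ∀ i j, ⟪B i, B j⟫ = if i = j then (1:ℝ) else 0 := by
          intro i j; exact orthonormal_iff_ite.1 B.orthonormal i j
        have huz : 0 ≤ ⟪u, z⟫ := by
          rw [real_inner_comm, hz.2]; exact suppFn_nonneg hR h0K u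
        have hgen : ∀ t : ℝ, |t| ≤ η → t * ⟪B j.succ, z⟫ ≤ M := by
          intro t ht
          have := core_le hR B S hN hε u hu.1.2.1 (hωS u hu.1) (hωS' u hu.1) (t • B j.succ)
            (by rw [inner_smul_right, hBB, if_neg (Fin.succ_ne_zero j).symm, mul_zero])
            (by
              intro i hi
              rw [inner_smul_right, hBB]
              split_ifs
              · simpa using ht
              · simpa using hη.le)
            (by
              intro i hi
              rw [inner_smul_right, hBB, if_neg, mul_zero]
              intro h
              exact hi (Fin.succ_injective _ h ▸ hj)) z hz.1
          rw [inner_smul_left] at this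
          simp only [conj_trivial] at this
          linarith
        have h1 := hgen η (abs_of_pos hη).le
        have h2 := hgen (-η) (by rw [abs_neg, abs_of_pos hη])
        have h3 : |⟪B j.succ, z⟫| * η = |⟪B j.succ, z⟫ * η| := by rw [abs_mul, abs_of_pos hη]
        rw [le_div_iff₀ hη, h3]
        exact abs_le.2 ⟨by linarith, by linarith⟩
      · simp only [hj, if_false]
        have h2 := abs_real_inner_le_norm (B j.succ) z
        rw [B.norm_eq_one, one_mul] at h2
        exact h2.trans (hR z hz.1))
  rw [prod_box S (by positivity) (by positivity)] at hup hlow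
  have hfin : ENNReal.ofReal (((m + 1 : ℕ) : ℝ) * τ1 * M ^ (p - 1)) *
      ENNReal.ofReal ((2 * η) ^ S.card * (2 * ε) ^ Sᶜ.card) ≤
      ((3 * m : ℝ≥0) : ℝ≥0∞) ^ (m:ℝ) * ENNReal.ofReal ((2 * (M / η)) ^ S.card * (2 * R) ^ Sᶜ.card) :=
    le_trans (by gcongr; exact hlow.trans hlow2) (hint.trans hup)
  have e3 : ((3 * m : ℝ≥0) : ℝ≥0∞) ^ (m:ℝ) = ENNReal.ofReal ((3 * m : ℝ) ^ (m:ℝ)) := by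
    rw [← ENNReal.ofReal_rpow_of_pos (by positivity)]
    congr 1
    rw [ENNReal.ofReal, Real.toNNReal_mul (by norm_num)]
    simp
  rw [e3, ← ENNReal.ofReal_mul (by positivity), ← ENNReal.ofReal_mul (by positivity)] at hfin
  exact (ENNReal.ofReal_le_ofReal_iff (by positivity)).1 hfin

/-- If `r ≥ 2` is an integer, `p < min {1, 2r - n}` and `K` solves the `L_p`
Minkowski problem with `o ∈ ∂K`, then `dim N(K,o) < r`. -/
theorem stmt8 {n : ℕ} (hn : 2 ≤ n) {r : ℕ} (hr : 2 ≤ r) {p : ℝ}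
    (hp : p < min 1 (2 * (r : ℝ) - (n : ℝ))) {τ1 τ2 : ℝ}
    (hτ1 : 0 < τ1) (hτ12 : τ1 < τ2) {f : EuclideanSpace ℝ (Fin n) → ℝ}
    (hf : ∀ u ∈ unitSphere n, τ1 < f u ∧ f u < τ2)
    {K : Set (EuclideanSpace ℝ (Fin n))} (hK : IsConvexBody0 K)
    (hsol : IsLpSolution p f K)
    (ho : (0 : EuclideanSpace ℝ (Fin n)) ∈ frontier K) :
    Module.finrank ℝ (Submodule.span ℝ (normalCone K 0)) < r := by
  by_contra hcon
  push Not at hcon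
  obtain ⟨m, rfl⟩ : ∃ m, n = m + 1 := ⟨n - 1, by omega⟩
  have hm : 1 ≤ m := by omega
  have hm0 : (0:ℝ) < m := by exact_mod_cast hm
  obtain ⟨B, S, hS, η₀, hη₀, hN₀⟩ := exists_frame K (by omega)
  obtain ⟨R₀, hR₀⟩ := hK.1.isBounded.exists_norm_le
  set R := max R₀ 1 with hRdef
  have hR1 : 1 ≤ R := le_max_right _ _
  have hR : ∀ y ∈ K, ‖y‖ ≤ R := fun y hy => (hR₀ y hy).trans (le_max_left _ _)
  set η : ℝ := min η₀ (1 / (4 * (m + 1))) with hηdef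
  have hη : 0 < η := by positivity
  have hη2 : η ^ 2 * (4 * (m + 1)) ≤ 1 := by
    have h1 : η ≤ 1 / (4 * ((m:ℝ) + 1)) := min_le_right _ _
    have h3 : 1 / (4 * ((m:ℝ) + 1)) ≤ 1 := by
      rw [div_le_one (by positivity)]; linarith
    rw [le_div_iff₀ (by positivity)] at h1
    have h4 : η ≤ 1 := (min_le_right _ _).trans h3
    nlinarith
  have hN : ∀ v, 1/2 ≤ ⟪B 0, v⟫ → (∀ j ∈ S, |⟪B j.succ, v⟫| ≤ 2 * η) →
        (∀ j ∉ S, ⟪B j.succ, v⟫ = 0) → v ∈ normalCone K 0 := by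
    intro v h1 h2 h3
    refine hN₀ v h1 (fun j hj => (h2 j hj).trans ?_) h3
    have : η ≤ η₀ := min_le_left _ _
    linarith
  have hcard : S.card + Sᶜ.card = m := by simpa using Finset.card_add_card_compl S
  have hp1 : p < 1 := hp.trans_le (min_le_left _ _)
  have hp2 : p < 2 * (r : ℝ) - ((m + 1 : ℕ) : ℝ) := hp.trans_le (min_le_right _ _)
  set A : ℝ := ((m + 1 : ℕ) : ℝ) * τ1 * (m * R) ^ (p - 1) * (2 * η) ^ S.card * 2 ^ Sᶜ.card with hA
  set D : ℝ := (3 * m : ℝ) ^ (m:ℝ) * ((2 * (m * R / η)) ^ S.card * (2 * R) ^ Sᶜ.card) with hD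
  have hA0 : 0 < A := by positivity
  set q : ℝ := (S.card : ℝ) - Sᶜ.card - (p - 1) with hq
  have hq0 : 0 < q := by
    have h1 : (S.card : ℝ) + Sᶜ.card = m := by exact_mod_cast hcard
    have h2 : (r : ℝ) ≤ S.card + 1 := by rw [← hS] at hcon; exact_mod_cast hcon
    push_cast at hp2
    rw [hq]; linarith
  have hineq : ∀ ε : ℝ, 0 < ε → ε ≤ η → A ≤ D * ε ^ q := by
    intro ε hε hεη
    have h := main_ineq hm hp1 hτ1 (fun u hu => (hf u hu).1) hR1 hR hK.2.2.2 hsol B S hη hη2 hN hε hεη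
    have e1 : (m * (ε * R)) ^ (p - 1) = (m * R) ^ (p - 1) * ε ^ (p - 1) := by
      rw [← Real.mul_rpow (by positivity) hε.le]; congr 1; ring
    have e2 : (2 * (m * (ε * R) / η)) ^ S.card = (2 * (m * R / η)) ^ S.card * ε ^ S.card := by
      rw [← mul_pow]; congr 1; ring
    have e3 : ε ^ q = ε ^ S.card / (ε ^ Sᶜ.card * ε ^ (p - 1)) := by
      rw [hq, Real.rpow_sub hε, Real.rpow_sub hε, Real.rpow_natCast, Real.rpow_natCast, div_div]
    rw [e1, e2, mul_pow 2 ε] at h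
    rw [e3, mul_div_assoc', le_div_iff₀ (by positivity)]
    calc _ = _ := by rw [hA]; ring
      _ ≤ _ := h
      _ = _ := by rw [hD]; ring
  have hlim : Filter.Tendsto (fun ε : ℝ => D * ε ^ q) (nhdsWithin 0 (Ioi 0)) (nhds 0) := by
    have : Filter.Tendsto (fun ε : ℝ => D * ε ^ q) (nhds 0) (nhds (D * 0 ^ q)) :=
      ((Real.continuousAt_rpow_const 0 q (Or.inr hq0.le)).tendsto).const_mul D
    rw [Real.zero_rpow hq0.ne', mul_zero] at this
    exact this.mono_left nhdsWithin_le_nhds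
  have : A ≤ 0 := by
    refine ge_of_tendsto hlim ?_
    filter_upwards [Ioc_mem_nhdsGT hη] with ε hε
    exact hineq ε hε.1 hε.2
  linarith
end
end
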